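/- Under the same assumptions on W (continuous, even, W(0)=0, C¹ away from 0, quadratic upper bound, and W(x)+(λ/2)|x|²+λ|x| convex), there exists τ₀ > 0 depending only on W such that for all 0 < τ < τ₀ and every μ̄ ∈ P₂(ℝ^d), the functional μ ↦ 𝒲[μ] + (1/2τ)W₂²(μ, μ̄) attains its minimum on P₂(ℝ^d). -/

import Mathlib

open MeasureTheory
open scoped ENNReal

noncomputable def sqW2 {E : Type*} [MeasurableSpace E] [PseudoMetricSpace E]
    (μ ν : Measure E) : ℝ≥0∞ :=
  ⨅ (γ : Measure (E × E)) (_ : γ.map Prod.fst = μ) (_ : γ.map Prod.snd = ν),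
    ∫⁻ p, ENNReal.ofReal (dist p.1 p.2 ^ 2) ∂γ

noncomputable def interactionEnergy {d : ℕ} (W : EuclideanSpace ℝ (Fin d) → ℝ)
    (μ : Measure (EuclideanSpace ℝ (Fin d))) : ℝ :=
  (1 / 2) * ∫ p, W (p.1 - p.2) ∂(μ.prod μ)

def FinSndMom {d : ℕ} (μ : Measure (EuclideanSpace ℝ (Fin d))) : Prop :=
  ∫⁻ x, (‖x‖₊ : ℝ≥0∞) ^ 2 ∂μ < ⊤

open Filter Topology

lemma mms_lsc {X : Type*} [TopologicalSpace X] [MeasurableSpace X] [OpensMeasurableSpace X]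
    (H : X → ℝ) (hc : Continuous H) (h0 : ∀ x, 0 ≤ H x) :
    LowerSemicontinuous (fun γ : ProbabilityMeasure X => ∫⁻ x, ENNReal.ofReal (H x) ∂(γ : Measure X)) := by
  have key : (fun γ : ProbabilityMeasure X => ∫⁻ x, ENNReal.ofReal (H x) ∂(γ : Measure X)) =
      fun γ : ProbabilityMeasure X => ⨆ n : ℕ, ∫⁻ x, ENNReal.ofReal (min (H x) n) ∂(γ : Measure X) := by
    funext γ
    rw [← lintegral_iSup]
    · congr 1
      funext x
      apply le_antisymm
      · obtain ⟨n, hn⟩ := exists_nat_ge (H x)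
        refine le_iSup_of_le n ?_
        rw [min_eq_left hn]
      · exact iSup_le fun n => ENNReal.ofReal_le_ofReal (min_le_left _ _)
    · intro n
      exact (ENNReal.continuous_ofReal.comp (hc.min continuous_const)).measurable
    · intro m n hmn x
      apply ENNReal.ofReal_le_ofReal
      exact min_le_min_left _ (by exact_mod_cast hmn)
  rw [key]
  refine lowerSemicontinuous_iSup fun n => Continuous.lowerSemicontinuous ?_
  let f : BoundedContinuousFunction X NNReal :=
    BoundedContinuousFunction.mkOfBound ⟨fun x => Real.toNNReal (min (H x) n),
      continuous_real_toNNReal.comp (hc.min continuous_const)⟩ n (by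
        intro x y
        rw [NNReal.dist_eq]
        simp only [ContinuousMap.coe_mk, Real.coe_toNNReal']
        have hn : (0:ℝ) ≤ n := Nat.cast_nonneg n
        have := h0 x; have := h0 y
        rw [max_eq_left (by positivity), max_eq_left (by positivity), abs_le]
        constructor <;> linarith [min_le_right (H x) n, min_le_right (H y) n,
          le_min (h0 x) hn, le_min (h0 y) hn])
  have hcont : Continuous fun γ : ProbabilityMeasure X => ∫⁻ x, (f x : ℝ≥0∞) ∂(γ : Measure X) := by
    rw [continuous_iff_continuousAt]
    intro γ
    exact (ProbabilityMeasure.tendsto_iff_forall_lintegral_tendsto.1 tendsto_id f)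
  exact hcont

lemma mms_compact {X : Type*} [NormedAddCommGroup X] [ProperSpace X] [MeasurableSpace X]
    [BorelSpace X] (M : ℝ≥0∞) (hM : M ≠ ⊤) :
    IsCompact {γ : ProbabilityMeasure X | ∫⁻ x, ENNReal.ofReal (‖x‖ ^ 2) ∂(γ : Measure X) ≤ M} := by
  have hcl : IsClosed {γ : ProbabilityMeasure X |
      ∫⁻ x, ENNReal.ofReal (‖x‖ ^ 2) ∂(γ : Measure X) ≤ M} :=
    (mms_lsc (fun x : X => ‖x‖ ^ 2) (by fun_prop) (fun x => by positivity)).isClosed_preimage M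
  rw [← hcl.closure_eq]
  apply isCompact_closure_of_isTightMeasureSet
  rw [isTightMeasureSet_iff_exists_isCompact_measure_compl_le]
  intro ε hε
  by_cases hεt : ε = ⊤
  · exact ⟨∅, isCompact_empty, fun _ _ => hεt ▸ le_top⟩
  obtain ⟨R, hR⟩ := exists_nat_ge (M / ε).toReal
  have hMR : M ≤ ε * ENNReal.ofReal ((R + 1 : ℝ) ^ 2) := by
    have h1 : M / ε ≠ ⊤ := (ENNReal.div_lt_top hM hε.ne').ne
    have h2 : M / ε ≤ ENNReal.ofReal ((R + 1 : ℝ) ^ 2) := by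
      rw [← ENNReal.ofReal_toReal h1]
      apply ENNReal.ofReal_le_ofReal
      nlinarith [(Nat.cast_nonneg R : (0:ℝ) ≤ R)]
    rw [mul_comm]
    exact (ENNReal.div_le_iff hε.ne' hεt).1 h2
  refine ⟨Metric.closedBall 0 (R + 1), isCompact_closedBall _ _, ?_⟩
  rintro _ ⟨γ, hγ, rfl⟩
  have hpos : ENNReal.ofReal ((R + 1 : ℝ) ^ 2) ≠ 0 := by
    simp only [ne_eq, ENNReal.ofReal_eq_zero, not_le]; positivity
  have h3 := mul_meas_ge_le_lintegral (μ := (γ : Measure X))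
    (f := fun x : X => ENNReal.ofReal (‖x‖ ^ 2)) (by fun_prop) (ENNReal.ofReal ((R + 1 : ℝ) ^ 2))
  have h4 : (γ : Measure X) (Metric.closedBall 0 (R + 1))ᶜ ≤
      (γ : Measure X) {x | ENNReal.ofReal ((R + 1 : ℝ) ^ 2) ≤ ENNReal.ofReal (‖x‖ ^ 2)} := by
    apply measure_mono
    intro x hx
    simp only [Set.mem_compl_iff, Metric.mem_closedBall, dist_zero_right, not_le] at hx
    apply ENNReal.ofReal_le_ofReal
    gcongr
  have h5 := (mul_le_mul_right h4 (ENNReal.ofReal ((R + 1 : ℝ) ^ 2))).trans (h3.trans (hγ.trans hMR))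
  rw [mul_comm ε] at h5
  exact (ENNReal.mul_le_mul_iff_right hpos ENNReal.ofReal_ne_top).1 h5

lemma mms_abstract {X : Type*} [NormedAddCommGroup X] [ProperSpace X] [MeasurableSpace X]
    [BorelSpace X] [SecondCountableTopology X] (H : X × X → ℝ) (hc : Continuous H) (δ : ℝ) (hδ : 0 < δ)
    (hH : ∀ p, δ * ‖p.1‖ ^ 2 ≤ H p) (S : Set (ProbabilityMeasure X)) (hS : IsClosed S)
    (γ₀ : ProbabilityMeasure X) (hγ₀ : γ₀ ∈ S)
    (hfin : ∫⁻ p, ENNReal.ofReal (H p) ∂((γ₀ : Measure X).prod γ₀) ≠ ⊤) :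
    ∃ γm ∈ S, ∫⁻ x, ENNReal.ofReal (‖x‖ ^ 2) ∂(γm : Measure X) ≠ ⊤ ∧
      ∀ γ ∈ S, ∫⁻ p, ENNReal.ofReal (H p) ∂((γm : Measure X).prod γm) ≤
        ∫⁻ p, ENNReal.ofReal (H p) ∂((γ : Measure X).prod γ) := by
  let Φ : ProbabilityMeasure X → ℝ≥0∞ :=
    fun γ => ∫⁻ p, ENNReal.ofReal (H p) ∂((γ : Measure X).prod γ)
  have hΦ : LowerSemicontinuous Φ := by
    have h1 := mms_lsc H hc (fun p => le_trans (by positivity) (hH p))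
    have h2 : Continuous fun γ : ProbabilityMeasure X => γ.prod γ :=
      ProbabilityMeasure.continuous_prod.comp (continuous_id.prodMk continuous_id)
    exact LowerSemicontinuous.comp h1 h2
  have hδ' : ENNReal.ofReal δ ≠ 0 := by simpa using hδ
  have hco : ∀ γ : ProbabilityMeasure X,
      ENNReal.ofReal δ * ∫⁻ x, ENNReal.ofReal (‖x‖ ^ 2) ∂(γ : Measure X) ≤ Φ γ := by
    intro γ
    rw [← lintegral_const_mul _ (by fun_prop)]
    have : (γ : Measure X) = ((γ : Measure X).prod (γ : Measure X)).map Prod.fst := by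
      simp
    rw [this, lintegral_map (by fun_prop) measurable_fst]
    apply lintegral_mono
    intro p
    simp only
    rw [← ENNReal.ofReal_mul hδ.le]
    exact ENNReal.ofReal_le_ofReal (hH p)
  let M := Φ γ₀ / ENNReal.ofReal δ
  have hM : M ≠ ⊤ := (ENNReal.div_lt_top hfin hδ').ne
  have hmem : ∀ γ, Φ γ ≤ Φ γ₀ → ∫⁻ x, ENNReal.ofReal (‖x‖ ^ 2) ∂(γ : Measure X) ≤ M := by
    intro γ hγ
    rw [ENNReal.le_div_iff_mul_le (Or.inl hδ') (Or.inl ENNReal.ofReal_ne_top), mul_comm]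
    exact (hco γ).trans hγ
  obtain ⟨γm, ⟨hm1, hm2⟩, hm3⟩ := LowerSemicontinuousOn.exists_isMinOn (f := Φ)
    (s := {γ : ProbabilityMeasure X | ∫⁻ x, ENNReal.ofReal (‖x‖ ^ 2) ∂(γ : Measure X) ≤ M} ∩ S)
    ⟨γ₀, hmem _ le_rfl, hγ₀⟩ ((mms_compact M hM).inter_right hS) (hΦ.lowerSemicontinuousOn _)
  refine ⟨γm, hm2, (lt_of_le_of_lt hm1 hM.lt_top).ne, fun γ hγ => ?_⟩
  by_cases h : Φ γ ≤ Φ γ₀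
  · exact hm3 ⟨hmem γ h, hγ⟩
  · exact (hm3 ⟨hmem _ le_rfl, hγ₀⟩).trans (not_le.1 h).le

abbrev MmsE (d : ℕ) := EuclideanSpace ℝ (Fin d)

lemma mms_W_lower {d : ℕ} (W : MmsE d → ℝ) (lam : ℝ) (hlam : 0 ≤ lam)
    (hWeven : ∀ z, W (-z) = W z) (hW0 : W 0 = 0)
    (hconv : ConvexOn ℝ Set.univ (fun z => W z + (lam / 2) * ‖z‖ ^ 2 + lam * ‖z‖)) (z : MmsE d) :
    -(lam * ‖z‖ ^ 2 + lam / 2) ≤ W z := by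
  have h := hconv.2 (Set.mem_univ z) (Set.mem_univ (-z))
    (by norm_num : (0:ℝ) ≤ 1 / 2) (by norm_num : (0:ℝ) ≤ 1 / 2) (by norm_num)
  simp only [smul_neg, add_neg_cancel, hW0, norm_zero, norm_neg, hWeven, smul_eq_mul] at h
  nlinarith [mul_nonneg hlam (sq_nonneg (‖z‖ - 1))]

lemma mms_finSnd_iff {d : ℕ} (μ : Measure (MmsE d)) :
    FinSndMom μ ↔ MemLp (fun x : MmsE d => x) 2 μ := by
  unfold FinSndMom
  have := eLpNorm_lt_top_iff_lintegral_rpow_enorm_lt_top (μ := μ) (p := 2)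
    (f := fun x : MmsE d => x) (by norm_num) (by norm_num)
  simp only [ENNReal.toReal_ofNat, ENNReal.rpow_ofNat] at this
  constructor
  · intro h
    exact ⟨aestronglyMeasurable_id, this.2 h⟩
  · intro h
    exact this.1 h.2

/-- the shifted, doubled integrand -/
noncomputable def mmsH {d : ℕ} (W : MmsE d → ℝ) (lam c A : ℝ)
    (p : (MmsE d × MmsE d) × (MmsE d × MmsE d)) : ℝ :=
  1 / 2 * W (p.1.1 - p.2.1) + c / 2 * (‖p.1.1 - p.1.2‖ ^ 2 + ‖p.2.1 - p.2.2‖ ^ 2)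
    + A * (‖p.1.2‖ ^ 2 + ‖p.2.2‖ ^ 2) + lam / 4

lemma mms_H_lower {d : ℕ} (W : MmsE d → ℝ) (lam c ε : ℝ) (hlam : 0 ≤ lam) (hε : 0 < ε)
    (hc : c / 2 = 3 * lam / 2 + ε)
    (hW : ∀ z, -(lam * ‖z‖ ^ 2 + lam / 2) ≤ W z)
    (p : (MmsE d × MmsE d) × (MmsE d × MmsE d)) :
    ε / 2 * ‖p.1‖ ^ 2 ≤ mmsH W lam c (3 * lam + 3 * ε) p := by
  obtain ⟨⟨x, y⟩, ⟨x', y'⟩⟩ := p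
  unfold mmsH
  simp only
  have h1 := hW (x - x')
  have h2 : ‖x - x'‖ ≤ ‖x - y‖ + (‖y‖ + ‖y'‖) + ‖x' - y'‖ := by
    have e : x - x' = (x - y) + (y - y') - (x' - y') := by abel
    rw [e]
    refine (norm_sub_le _ _).trans ?_
    gcongr
    refine (norm_add_le _ _).trans ?_
    gcongr
    exact norm_sub_le _ _
  have h3 : ‖x - x'‖ ^ 2 ≤ 3 * (‖x - y‖ ^ 2 + ‖x' - y'‖ ^ 2) + 6 * (‖y‖ ^ 2 + ‖y'‖ ^ 2) := by
    have := pow_le_pow_left₀ (norm_nonneg _) h2 2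
    refine this.trans ?_
    nlinarith [sq_nonneg (‖x - y‖ - (‖y‖ + ‖y'‖)), sq_nonneg (‖x - y‖ - ‖x' - y'‖),
      sq_nonneg (‖x' - y'‖ - (‖y‖ + ‖y'‖)), sq_nonneg (‖y‖ - ‖y'‖)]
  have h4 : ‖x‖ ≤ ‖x - y‖ + ‖y‖ := by
    simpa using norm_add_le (x - y) y
  have h5 : ‖((x, y) : MmsE d × MmsE d)‖ ^ 2 ≤ 2 * ‖x - y‖ ^ 2 + 3 * ‖y‖ ^ 2 := by
    rw [Prod.norm_mk]
    rcases max_choice ‖x‖ ‖y‖ with h | h <;> rw [h]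
    · have := pow_le_pow_left₀ (norm_nonneg _) h4 2
      nlinarith [sq_nonneg (‖x - y‖ - ‖y‖), sq_nonneg ‖y‖]
    · nlinarith [sq_nonneg ‖x - y‖, sq_nonneg ‖y‖]
  have h6 := mul_le_mul_of_nonneg_left h3 hlam
  have h7 := mul_le_mul_of_nonneg_left h5 hε.le
  have h8 : 0 ≤ ε * ‖x' - y'‖ ^ 2 := by positivity
  have h9 : 0 ≤ ε * ‖y'‖ ^ 2 := by positivity
  have h10 : 0 ≤ ε * ‖y‖ ^ 2 := by positivity
  rw [hc]
  nlinarith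

lemma mms_W_integrable {d : ℕ} (W : MmsE d → ℝ) (hWc : Continuous W) (B : ℝ)
    (hB : ∀ z, |W z| ≤ B * (1 + ‖z‖ ^ 2)) (μ : Measure (MmsE d)) [IsProbabilityMeasure μ]
    (hμ : MemLp (fun x : MmsE d => x) 2 μ) :
    Integrable (fun p : MmsE d × MmsE d => W (p.1 - p.2)) (μ.prod μ) := by
  have h1 : MemLp (fun p : MmsE d × MmsE d => p.1) 2 (μ.prod μ) :=
    hμ.comp_measurePreserving measurePreserving_fst
  have h2 : MemLp (fun p : MmsE d × MmsE d => p.2) 2 (μ.prod μ) :=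
    hμ.comp_measurePreserving measurePreserving_snd
  have h3 : Integrable (fun p : MmsE d × MmsE d => ‖p.1 - p.2‖ ^ 2) (μ.prod μ) :=
    (h1.sub h2).integrable_norm_pow (p := 2) (by norm_num)
  have h4 : Integrable (fun p : MmsE d × MmsE d => B * (1 + ‖p.1 - p.2‖ ^ 2)) (μ.prod μ) :=
    ((integrable_const _).add h3).const_mul B
  exact h4.mono' (by fun_prop) (ae_of_all _ fun p => hB _)

lemma mms_value {d : ℕ} (W : MmsE d → ℝ) (hWc : Continuous W) (B : ℝ)
    (hB : ∀ z, |W z| ≤ B * (1 + ‖z‖ ^ 2)) (lam c A : ℝ)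
    (hH : ∀ p, 0 ≤ mmsH W lam c A p)
    (μ ν : Measure (MmsE d)) [IsProbabilityMeasure μ] [IsProbabilityMeasure ν]
    (γ : Measure (MmsE d × MmsE d)) [IsProbabilityMeasure γ]
    (h1 : γ.map Prod.fst = μ) (h2 : γ.map Prod.snd = ν)
    (hμ : MemLp (fun x : MmsE d => x) 2 μ) (hν : MemLp (fun x : MmsE d => x) 2 ν) :
    0 ≤ interactionEnergy W μ
      + c * (∫⁻ p, ENNReal.ofReal (dist p.1 p.2 ^ 2) ∂γ).toReal
      + 2 * A * ∫ y, ‖y‖ ^ 2 ∂ν + lam / 4 ∧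
    ∫⁻ p, ENNReal.ofReal (mmsH W lam c A p) ∂(γ.prod γ) =
    ENNReal.ofReal (interactionEnergy W μ
      + c * (∫⁻ p, ENNReal.ofReal (dist p.1 p.2 ^ 2) ∂γ).toReal
      + 2 * A * ∫ y, ‖y‖ ^ 2 ∂ν + lam / 4) := by
  have m1 : MeasurePreserving Prod.fst γ μ := ⟨measurable_fst, h1⟩
  have m2 : MeasurePreserving Prod.snd γ ν := ⟨measurable_snd, h2⟩
  have L1 : MemLp (fun p : MmsE d × MmsE d => p.1) 2 γ := hμ.comp_measurePreserving m1
  have L2 : MemLp (fun p : MmsE d × MmsE d => p.2) 2 γ := hν.comp_measurePreserving m2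
  have D : Integrable (fun p : MmsE d × MmsE d => ‖p.1 - p.2‖ ^ 2) γ :=
    (L1.sub L2).integrable_norm_pow (p := 2) (by norm_num)
  have N : Integrable (fun p : MmsE d × MmsE d => ‖p.2‖ ^ 2) γ :=
    L2.integrable_norm_pow (p := 2) (by norm_num)
  have f1 : MeasurePreserving Prod.fst (γ.prod γ) γ := measurePreserving_fst
  have f2 : MeasurePreserving Prod.snd (γ.prod γ) γ := measurePreserving_snd
  have mm : MeasurePreserving (Prod.map Prod.fst Prod.fst) (γ.prod γ) (μ.prod μ) := m1.prod m1
  have IW : Integrable (fun p : (MmsE d × MmsE d) × (MmsE d × MmsE d) => W (p.1.1 - p.2.1))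
      (γ.prod γ) :=
    mm.integrable_comp_of_integrable (mms_W_integrable W hWc B hB μ hμ)
  have D1 : Integrable (fun p : (MmsE d × MmsE d) × (MmsE d × MmsE d) => ‖p.1.1 - p.1.2‖ ^ 2)
      (γ.prod γ) := f1.integrable_comp_of_integrable D
  have D2 : Integrable (fun p : (MmsE d × MmsE d) × (MmsE d × MmsE d) => ‖p.2.1 - p.2.2‖ ^ 2)
      (γ.prod γ) := f2.integrable_comp_of_integrable D
  have N1 : Integrable (fun p : (MmsE d × MmsE d) × (MmsE d × MmsE d) => ‖p.1.2‖ ^ 2)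
      (γ.prod γ) := f1.integrable_comp_of_integrable N
  have N2 : Integrable (fun p : (MmsE d × MmsE d) × (MmsE d × MmsE d) => ‖p.2.2‖ ^ 2)
      (γ.prod γ) := f2.integrable_comp_of_integrable N
  have eW : ∫ p : (MmsE d × MmsE d) × (MmsE d × MmsE d), W (p.1.1 - p.2.1) ∂(γ.prod γ)
      = ∫ p, W (p.1 - p.2) ∂(μ.prod μ) := by
    rw [← mm.map_eq, integral_map mm.measurable.aemeasurable (by fun_prop)]
    rfl
  have eD1 : ∫ p : (MmsE d × MmsE d) × (MmsE d × MmsE d), ‖p.1.1 - p.1.2‖ ^ 2 ∂(γ.prod γ)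
      = ∫ p, ‖p.1 - p.2‖ ^ 2 ∂γ := by
    conv_rhs => rw [← f1.map_eq, integral_map f1.measurable.aemeasurable (by fun_prop)]
  have eD2 : ∫ p : (MmsE d × MmsE d) × (MmsE d × MmsE d), ‖p.2.1 - p.2.2‖ ^ 2 ∂(γ.prod γ)
      = ∫ p, ‖p.1 - p.2‖ ^ 2 ∂γ := by
    conv_rhs => rw [← f2.map_eq, integral_map f2.measurable.aemeasurable (by fun_prop)]
  have eN : ∫ p, ‖p.2‖ ^ 2 ∂γ = ∫ y, ‖y‖ ^ 2 ∂ν := by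
    conv_rhs => rw [← m2.map_eq, integral_map m2.measurable.aemeasurable (by fun_prop)]
  have eN1 : ∫ p : (MmsE d × MmsE d) × (MmsE d × MmsE d), ‖p.1.2‖ ^ 2 ∂(γ.prod γ)
      = ∫ y, ‖y‖ ^ 2 ∂ν := by
    rw [← eN]
    conv_rhs => rw [← f1.map_eq, integral_map f1.measurable.aemeasurable (by fun_prop)]
  have eN2 : ∫ p : (MmsE d × MmsE d) × (MmsE d × MmsE d), ‖p.2.2‖ ^ 2 ∂(γ.prod γ)
      = ∫ y, ‖y‖ ^ 2 ∂ν := by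
    rw [← eN]
    conv_rhs => rw [← f2.map_eq, integral_map f2.measurable.aemeasurable (by fun_prop)]
  have ecost : (∫⁻ p, ENNReal.ofReal (dist p.1 p.2 ^ 2) ∂γ).toReal = ∫ p, ‖p.1 - p.2‖ ^ 2 ∂γ := by
    rw [integral_eq_lintegral_of_nonneg_ae (ae_of_all _ fun p => by positivity) (by fun_prop)]
    simp only [dist_eq_norm]
  have J1 : Integrable (fun p : (MmsE d × MmsE d) × (MmsE d × MmsE d) =>
      1 / 2 * W (p.1.1 - p.2.1)) (γ.prod γ) := IW.const_mul _
  have J2 : Integrable (fun p : (MmsE d × MmsE d) × (MmsE d × MmsE d) =>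
      c / 2 * (‖p.1.1 - p.1.2‖ ^ 2 + ‖p.2.1 - p.2.2‖ ^ 2)) (γ.prod γ) := (D1.add D2).const_mul _
  have J3 : Integrable (fun p : (MmsE d × MmsE d) × (MmsE d × MmsE d) =>
      A * (‖p.1.2‖ ^ 2 + ‖p.2.2‖ ^ 2)) (γ.prod γ) := (N1.add N2).const_mul _
  have J4 : Integrable (fun p : (MmsE d × MmsE d) × (MmsE d × MmsE d) =>
      lam / 4) (γ.prod γ) := integrable_const _
  have J12 := J1.add J2
  have J123 := J12.add J3
  have JH : Integrable (mmsH W lam c A) (γ.prod γ) := J123.add J4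
  have e : ∫ p, mmsH W lam c A p ∂(γ.prod γ) = interactionEnergy W μ
      + c * (∫⁻ p, ENNReal.ofReal (dist p.1 p.2 ^ 2) ∂γ).toReal
      + 2 * A * ∫ y, ‖y‖ ^ 2 ∂ν + lam / 4 := by
    have s1 := integral_add J123 J4
    have s2 := integral_add J12 J3
    have s3 := integral_add J1 J2
    simp only [Pi.add_apply] at s1 s2 s3
    unfold mmsH
    rw [s1, s2, s3, integral_const_mul, integral_const_mul, integral_const_mul,
      integral_add D1 D2, integral_add N1 N2, eW, eD1, eD2, eN1, eN2, ecost]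
    simp only [integral_const, probReal_univ, one_smul, interactionEnergy]
    ring
  rw [← e]
  exact ⟨integral_nonneg hH, (ofReal_integral_eq_lintegral_ofReal JH (ae_of_all _ hH)).symm⟩

/-- Existence of minimizers for one step of the minimizing movement scheme: for `τ`
small (depending only on `W`) the penalized energy `𝒲[·] + (1/2τ)W₂²(·, μ̄)` attains
its minimum on `P₂(ℝ^d)`. -/
theorem exists_minimizer_mms {d : ℕ}
    (W : EuclideanSpace ℝ (Fin d) → ℝ) (lam : ℝ) (hlam : 0 ≤ lam)
    (hWc : Continuous W) (hWeven : ∀ z, W (-z) = W z) (hW0 : W 0 = 0)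
    (hWC1 : ContDiffOn ℝ 1 W {(0 : EuclideanSpace ℝ (Fin d))}ᶜ)
    (hWquad : ∃ C > 0, ∀ z, W z ≤ C * (1 + ‖z‖ ^ 2))
    (hconv : ConvexOn ℝ Set.univ (fun z => W z + (lam / 2) * ‖z‖ ^ 2 + lam * ‖z‖)) :
    ∃ τ₀ > 0, ∀ τ : ℝ, 0 < τ → τ < τ₀ →
      ∀ μbar : Measure (EuclideanSpace ℝ (Fin d)), IsProbabilityMeasure μbar →
        FinSndMom μbar →
        ∃ μmin : Measure (EuclideanSpace ℝ (Fin d)), IsProbabilityMeasure μmin ∧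
          FinSndMom μmin ∧
          ∀ μ : Measure (EuclideanSpace ℝ (Fin d)), IsProbabilityMeasure μ →
            FinSndMom μ →
            interactionEnergy W μmin + (1 / (2 * τ)) * (sqW2 μmin μbar).toReal ≤
              interactionEnergy W μ + (1 / (2 * τ)) * (sqW2 μ μbar).toReal := by
  obtain ⟨C, hC, hWC⟩ := hWquad
  have hWl := mms_W_lower W lam hlam hWeven hW0 hconv
  have hB : ∀ z, |W z| ≤ (C + lam) * (1 + ‖z‖ ^ 2) := by
    intro z
    rw [abs_le]
    have h1 := hWC z
    have h2 := hWl z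
    have h3 : 0 ≤ lam * ‖z‖ ^ 2 := by positivity
    have h4 : 0 ≤ C * ‖z‖ ^ 2 := by positivity
    constructor <;> nlinarith
  refine ⟨1 / (6 * lam + 1), by positivity, fun τ hτ hττ ν hνp hν => ?_⟩
  rw [mms_finSnd_iff] at hν
  set c : ℝ := 1 / (2 * τ) with hc
  have hcpos : 0 < c := by positivity
  obtain ⟨ε, hε⟩ : ∃ ε, ε = c / 2 - 3 * lam / 2 := ⟨_, rfl⟩
  have hεpos : 0 < ε := by
    have h1 : τ * (6 * lam + 1) < 1 := (lt_div_iff₀ (by positivity)).1 hττ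
    have h2 : c * (2 * τ) = 1 := by rw [hc]; field_simp
    have h3 : 0 < (c - 3 * lam) * (2 * τ) := by nlinarith
    have := pos_of_mul_pos_left h3 (by positivity)
    rw [hε]; linarith
  have hHl := mms_H_lower W lam c ε hlam hεpos (by rw [hε]; ring) hWl
  set A := 3 * lam + 3 * ε with hA
  have hH0 : ∀ p, 0 ≤ mmsH W lam c A p := fun p => le_trans (by positivity) (hHl p)
  have hHc : Continuous (mmsH W lam c A) := by unfold mmsH; fun_prop
  let S : Set (ProbabilityMeasure (MmsE d × MmsE d)) :=
    {γ | γ.map (f := Prod.snd) measurable_snd.aemeasurable = ⟨ν, hνp⟩}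
  have hS : IsClosed S :=
    isClosed_singleton.preimage (ProbabilityMeasure.continuous_map continuous_snd)
  have hSiff : ∀ γ : ProbabilityMeasure (MmsE d × MmsE d),
      γ ∈ S ↔ (γ : Measure (MmsE d × MmsE d)).map Prod.snd = ν := by
    intro γ
    exact Subtype.ext_iff
  have hval := mms_value W hWc (C + lam) hB lam c A hH0
  obtain ⟨γm, hmS, hmfin, hmin⟩ := mms_abstract (mmsH W lam c A) hHc (ε / 2) (by positivity) hHl S hS
    ⟨ν.prod ν, inferInstance⟩ ((hSiff _).2 (by simp)) (by
      simp only [ProbabilityMeasure.coe_mk]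
      rw [(hval ν ν (ν.prod ν) (by simp) (by simp) hν hν).2]
      exact ENNReal.ofReal_ne_top)
  rw [hSiff] at hmS
  have hmp : IsProbabilityMeasure ((γm : Measure (MmsE d × MmsE d)).map Prod.fst) :=
    Measure.isProbabilityMeasure_map measurable_fst.aemeasurable
  have hmom : FinSndMom ((γm : Measure (MmsE d × MmsE d)).map Prod.fst) := by
    unfold FinSndMom
    rw [lintegral_map (by fun_prop) measurable_fst]
    refine lt_of_le_of_lt (lintegral_mono fun p => ?_) hmfin.lt_top
    rw [ENNReal.ofReal_pow (norm_nonneg _), ofReal_norm]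
    gcongr
    exact ENNReal.coe_le_coe.2 (norm_fst_le p)
  refine ⟨_, hmp, hmom, fun μ hμp hμ => ?_⟩
  set μm := (γm : Measure (MmsE d × MmsE d)).map Prod.fst with hμm
  rw [mms_finSnd_iff] at hmom hμ
  have hfincost : ∀ (μ₁ : Measure (MmsE d)) (γ : Measure (MmsE d × MmsE d)),
      MemLp (fun x : MmsE d => x) 2 μ₁ → γ.map Prod.fst = μ₁ → γ.map Prod.snd = ν →
      ∫⁻ p, ENNReal.ofReal (dist p.1 p.2 ^ 2) ∂γ ≠ ⊤ := by
    intro μ₁ γ hμ₁ h1 h2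
    have L1 : MemLp (fun p : MmsE d × MmsE d => p.1) 2 γ :=
      hμ₁.comp_measurePreserving ⟨measurable_fst, h1⟩
    have L2 : MemLp (fun p : MmsE d × MmsE d => p.2) 2 γ :=
      hν.comp_measurePreserving ⟨measurable_snd, h2⟩
    have D : Integrable (fun p : MmsE d × MmsE d => ‖p.1 - p.2‖ ^ 2) γ :=
      (L1.sub L2).integrable_norm_pow (p := 2) (by norm_num)
    simp only [dist_eq_norm]
    exact D.lintegral_lt_top.ne
  have hle : ∀ (μ₁ : Measure (MmsE d)) (γ : Measure (MmsE d × MmsE d)),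
      γ.map Prod.fst = μ₁ → γ.map Prod.snd = ν →
      sqW2 μ₁ ν ≤ ∫⁻ p, ENNReal.ofReal (dist p.1 p.2 ^ 2) ∂γ := by
    intro μ₁ γ h1 h2
    exact iInf_le_of_le γ (iInf_le_of_le h1 (iInf_le_of_le h2 le_rfl))
  have hWfin : sqW2 μ ν ≠ ⊤ :=
    ne_top_of_le_ne_top (hfincost μ (μ.prod ν) hμ (by simp) (by simp))
      (hle μ (μ.prod ν) (by simp) (by simp))
  have hm1 : (sqW2 μm ν).toReal ≤
      (∫⁻ p, ENNReal.ofReal (dist p.1 p.2 ^ 2) ∂(γm : Measure (MmsE d × MmsE d))).toReal :=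
    ENNReal.toReal_mono (hfincost μm γm hmom rfl hmS) (hle μm γm rfl hmS)
  have key : ENNReal.ofReal ((interactionEnergy W μm + c * (sqW2 μm ν).toReal
      - interactionEnergy W μ) / c) ≤ sqW2 μ ν := by
    refine le_iInf fun γ => le_iInf fun h1 => le_iInf fun h2 => ?_
    have hγp : IsProbabilityMeasure γ := by
      constructor
      have : γ.map Prod.fst Set.univ = 1 := by rw [h1]; exact measure_univ
      rwa [Measure.map_apply measurable_fst MeasurableSet.univ, Set.preimage_univ] at this
    have hcmp := hmin ⟨γ, hγp⟩ ((hSiff _).2 h2)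
    simp only [ProbabilityMeasure.coe_mk] at hcmp
    obtain ⟨v1, v2⟩ := hval μ ν γ h1 h2 hμ hν
    obtain ⟨w1, w2⟩ := hval μm ν γm rfl hmS hmom hν
    rw [v2, w2, ENNReal.ofReal_le_ofReal_iff v1] at hcmp
    rw [ENNReal.ofReal_le_iff_le_toReal (hfincost μ γ hμ h1 h2), div_le_iff₀ hcpos]
    have := mul_le_mul_of_nonneg_left hm1 hcpos.le
    linarith
  rw [ENNReal.ofReal_le_iff_le_toReal hWfin, div_le_iff₀ hcpos] at key
  linarith
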